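/- Let f = (u, p) : X^m → Y^n be a multiset mapping with u injective and p a bijection from m* onto n*, and let A ∈ X^m. Then f(Aᶜ) ⊆ (f(A))ᶜ, i.e. for every y ∈ Y, f(Aᶜ)(y) ≤ n − f(A)(y). If moreover u is also surjective (so f is bijective), then f(Aᶜ) = (f(A))ᶜ. -/

import Mathlib

/-- The image of a multiset (count function) `A` under a multiset mapping
`f = (u, p)`: `f(A)(y) = p (sup {A x : u x = y})`, with `sup ∅ = 0` in ℕ. -/
noncomputable def msImage {X Y : Type*} (u : X → Y) (p : ℕ → ℕ) (A : X → ℕ) : Y → ℕ :=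
  fun y => p (sSup (A '' (u ⁻¹' {y})))

/-- A monotone bijection from `{0, …, m}` onto `{0, …, n}` fixing `0` is the identity. -/
theorem eq_self_of_monotone_bijection {m n : ℕ} {p : ℕ → ℕ} (hp0 : p 0 = 0)
    (hmono : ∀ i j, i ≤ j → j ≤ m → p i ≤ p j)
    (hbd : ∀ i, i ≤ m → p i ≤ n)
    (hpinj : ∀ i, i ≤ m → ∀ j, j ≤ m → p i = p j → i = j)
    (hpsurj : ∀ j, j ≤ n → ∃ i, i ≤ m ∧ p i = j) :
    ∀ i, i ≤ m → p i = i := by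
  intro i
  induction i with
  | zero => exact fun _ => hp0
  | succ i ih =>
    intro hi
    have hpi := ih (by omega)
    have hle := hmono i (i + 1) (by omega) hi
    have hne : p i ≠ p (i + 1) := fun h => by
      have := hpinj i (by omega) (i + 1) hi h
      omega
    have hn := hbd (i + 1) hi
    obtain ⟨k, hk, hpk⟩ := hpsurj (i + 1) (by omega)
    rcases Nat.lt_or_ge i k with h | h
    · have := hmono (i + 1) k h hk
      omega
    · have := hmono k i h (by omega)
      omega

theorem msImage_apply_of_injective {X Y : Type*} {u : X → Y} (hu : Function.Injective u)
    (p : ℕ → ℕ) (A : X → ℕ) (x : X) : msImage u p A (u x) = p (A x) := by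
  have h : u ⁻¹' {u x} = {x} := by
    ext z
    simp [hu.eq_iff]
  simp [msImage, h]

theorem msImage_of_notMem_range {X Y : Type*} {u : X → Y} {p : ℕ → ℕ} (hp0 : p 0 = 0)
    (A : X → ℕ) {y : Y} (hy : y ∉ Set.range u) : msImage u p A y = 0 := by
  simp [msImage, Set.preimage_singleton_eq_empty.mpr hy, hp0]

/-- For a multiset mapping `f = (u, p) : X^m → Y^n` with `u`
injective and `p` a bijection from `m*` onto `n*`, and `A ∈ X^m`:
`f(Aᶜ) ⊆ (f(A))ᶜ`, i.e. `∀ y, f(Aᶜ)(y) ≤ n − f(A)(y)`; if moreover `u` is also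
surjective (so `f` is bijective), then `f(Aᶜ) = (f(A))ᶜ`. -/
theorem stmt_9 {X Y : Type*} (m n : ℕ) (u : X → Y) (p : ℕ → ℕ)
    (hp0 : p 0 = 0) (hpm : p m = n)
    (hmono : ∀ i j, i ≤ j → j ≤ m → p i ≤ p j)
    (hbd : ∀ i, i ≤ m → p i ≤ n)
    (huinj : Function.Injective u)
    (hpinj : ∀ i, i ≤ m → ∀ j, j ≤ m → p i = p j → i = j)
    (hpsurj : ∀ j, j ≤ n → ∃ i, i ≤ m ∧ p i = j)
    (A : X → ℕ) (hA : ∀ x, A x ≤ m) :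
    (∀ y : Y, msImage u p (fun x => m - A x) y ≤ n - msImage u p A y) ∧
    (Function.Surjective u →
      ∀ y : Y, msImage u p (fun x => m - A x) y = n - msImage u p A y) := by
  have hp := eq_self_of_monotone_bijection hp0 hmono hbd hpinj hpsurj
  have hmn : m = n := (hp m le_rfl).symm.trans hpm
  have key : ∀ x, msImage u p (fun x => m - A x) (u x) = n - msImage u p A (u x) := by
    intro x
    rw [msImage_apply_of_injective huinj, msImage_apply_of_injective huinj,
      hp _ (Nat.sub_le _ _), hp _ (hA x), hmn]
  refine ⟨fun y => ?_, fun hu y => ?_⟩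
  · by_cases hy : y ∈ Set.range u
    · obtain ⟨x, rfl⟩ := hy
      exact (key x).le
    · rw [msImage_of_notMem_range hp0 _ hy]
      exact Nat.zero_le _
  · obtain ⟨x, rfl⟩ := hu y
    exact key x
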